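/- arXiv:1806.07562 — 3 statements merged into one kernel-verified Lean document; each statement's English description precedes it below -/
import Mathlib

section
/- Let p ∈ (0,1), λ > 0 and let μ, ν be strictly positive probability mass functions on a finite label set L. For ε ∈ (0,1) set a = 1 + ((1−p)/p)ε, b = 1−ε, c = 1 + (p/(1−p))ε. Then lim_{ε→0⁺} (λ/ε²)·∑_{ℓ∈L} ( p·a·μ(ℓ) + (1−p)·b·ν(ℓ) ) · log( (a·p·μ(ℓ) + b·(1−p)·ν(ℓ)) / (b·p·μ(ℓ) + c·(1−p)·ν(ℓ)) ) = (λ/2)·∑_{ℓ∈L} (μ(ℓ)−ν(ℓ))² / (p·μ(ℓ)+(1−p)·ν(ℓ)). -/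
open Filter

/-- Second order expansion of `(1 + t) log (1 + t)` at `0`, with a cubic remainder bound. -/
theorem abs_one_add_mul_log_one_add_sub_le {t : ℝ} (ht : |t| ≤ 1 / 2) :
    |(1 + t) * Real.log (1 + t) - t - t ^ 2 / 2| ≤ 4 * |t| ^ 3 := by
  have h := Real.abs_log_sub_add_sum_range_le (x := -t) (by rw [abs_neg]; linarith) 2
  simp only [Finset.sum_range_succ, Finset.sum_range_zero, abs_neg, sub_neg_eq_add] at h
  norm_num at h
  set r := -t + t ^ 2 / 2 + Real.log (1 + t) with hr
  have hr_le : |r| ≤ 2 * |t| ^ 3 := by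
    refine h.trans ?_
    rw [div_le_iff₀ (by linarith)]
    nlinarith [pow_nonneg (abs_nonneg t) 3]
  have h1 : |1 + t| ≤ 3 / 2 := by
    have := abs_add_le 1 t
    rw [abs_one] at this
    linarith
  have h2 : (1 + t) * Real.log (1 + t) - t - t ^ 2 / 2 = -(t ^ 3 / 2) + (1 + t) * r := by
    rw [hr]; ring
  have h3 : |(1 + t) * r| ≤ 3 / 2 * (2 * |t| ^ 3) := by
    rw [abs_mul]
    exact mul_le_mul h1 hr_le (abs_nonneg _) (by norm_num)
  have h4 : |-(t ^ 3 / 2)| = |t| ^ 3 / 2 := by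
    rw [abs_neg, abs_div, abs_pow, abs_two]
  rw [h2]
  have := abs_add_le (-(t ^ 3 / 2)) ((1 + t) * r)
  have := pow_nonneg (abs_nonneg t) 3
  linarith

/-- If `B ε → m > 0`, then `(B + εδ) log ((B + εδ) / B) - εδ` is asymptotically
`ε² δ² / (2m)` as `ε → 0⁺`. -/
theorem tendsto_mul_log_div_sub_div_sq {B : ℝ → ℝ} {m : ℝ} (hm : 0 < m) (δ : ℝ)
    (hB : Tendsto B (nhdsWithin 0 (Set.Ioi 0)) (nhds m)) :
    Tendsto (fun ε : ℝ =>
        ((B ε + ε * δ) * Real.log ((B ε + ε * δ) / B ε) - ε * δ) / ε ^ 2)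
      (nhdsWithin 0 (Set.Ioi 0)) (nhds (δ ^ 2 / (2 * m))) := by
  have hε : Tendsto (fun ε : ℝ => ε) (nhdsWithin 0 (Set.Ioi 0)) (nhds 0) :=
    tendsto_id.mono_left nhdsWithin_le_nhds
  have ht : Tendsto (fun ε : ℝ => |ε * δ / B ε|) (nhdsWithin 0 (Set.Ioi 0)) (nhds 0) := by
    simpa using ((hε.mul_const δ).div hB hm.ne').abs
  have hmain : Tendsto (fun ε : ℝ => δ ^ 2 / (2 * B ε)) (nhdsWithin 0 (Set.Ioi 0))
      (nhds (δ ^ 2 / (2 * m))) :=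
    tendsto_const_nhds.div (hB.const_mul 2) (by positivity)
  have hbound : Tendsto (fun ε : ℝ => 4 * (δ ^ 2 / B ε) * |ε * δ / B ε|)
      (nhdsWithin 0 (Set.Ioi 0)) (nhds 0) := by
    simpa using ((tendsto_const_nhds.div hB hm.ne').const_mul 4).mul ht
  have hdiff : Tendsto (fun ε : ℝ =>
      ((B ε + ε * δ) * Real.log ((B ε + ε * δ) / B ε) - ε * δ) / ε ^ 2 - δ ^ 2 / (2 * B ε))
      (nhdsWithin 0 (Set.Ioi 0)) (nhds 0) := by
    refine squeeze_zero_norm' ?_ hbound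
    filter_upwards [self_mem_nhdsWithin, hB.eventually (lt_mem_nhds hm),
      ht.eventually (gt_mem_nhds (by norm_num : (0 : ℝ) < 1 / 2))] with ε hpos hBpos hlt
    have hpos : 0 < ε := hpos
    have hle := abs_one_add_mul_log_one_add_sub_le hlt.le
    set t := ε * δ / B ε with htdef
    have hmul : ε * δ = B ε * t := by rw [htdef]; field_simp
    have hdiv : (B ε + ε * δ) / B ε = 1 + t := by rw [htdef]; field_simp
    have hsq : δ ^ 2 / B ε = B ε * t ^ 2 / ε ^ 2 := by rw [htdef]; field_simp
    have heq : ((B ε + ε * δ) * Real.log ((B ε + ε * δ) / B ε) - ε * δ) / ε ^ 2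
        - δ ^ 2 / (2 * B ε)
        = B ε / ε ^ 2 * ((1 + t) * Real.log (1 + t) - t - t ^ 2 / 2) := by
      have : δ ^ 2 / (2 * B ε) = δ ^ 2 / B ε / 2 := by field_simp
      rw [this, hdiv, hsq, hmul]
      ring
    have hcoef : 0 < B ε / ε ^ 2 := by positivity
    rw [heq, Real.norm_eq_abs, abs_mul, abs_of_pos hcoef, hsq]
    calc B ε / ε ^ 2 * |(1 + t) * Real.log (1 + t) - t - t ^ 2 / 2|
        ≤ B ε / ε ^ 2 * (4 * |t| ^ 3) := mul_le_mul_of_nonneg_left hle hcoef.le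
      _ = 4 * (B ε * t ^ 2 / ε ^ 2) * |t| := by rw [← sq_abs t]; ring
  simpa using hdiff.add hmain

/-- The mean term of the Poisson sum in Lemma 1 converges, as `ε → 0⁺`,
to `α₁/2 = (λ/2)·∑ (μ(ℓ)−ν(ℓ))²/(pμ(ℓ)+(1−p)ν(ℓ))`. -/
theorem stmt_11 {L : Type*} [Fintype L] (p lam : ℝ) (hp : p ∈ Set.Ioo (0 : ℝ) 1)
    (hlam : 0 < lam) (μ ν : L → ℝ) (hμ0 : ∀ ℓ, 0 < μ ℓ) (hν0 : ∀ ℓ, 0 < ν ℓ)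
    (hμ1 : ∑ ℓ, μ ℓ = 1) (hν1 : ∑ ℓ, ν ℓ = 1) :
    Tendsto (fun ε : ℝ =>
        (lam / ε ^ 2) * ∑ ℓ,
          (p * (1 + ((1 - p) / p) * ε) * μ ℓ + (1 - p) * (1 - ε) * ν ℓ) *
            Real.log (((1 + ((1 - p) / p) * ε) * p * μ ℓ + (1 - ε) * (1 - p) * ν ℓ) /
                      ((1 - ε) * p * μ ℓ + (1 + (p / (1 - p)) * ε) * (1 - p) * ν ℓ)))
      (nhdsWithin 0 (Set.Ioi 0))
      (nhds ((lam / 2) * ∑ ℓ, (μ ℓ - ν ℓ) ^ 2 / (p * μ ℓ + (1 - p) * ν ℓ))) := by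
  obtain ⟨hp0, hp1⟩ := hp
  have hq : 0 < 1 - p := by linarith
  have key : ∀ ℓ, Tendsto (fun ε : ℝ =>
      ((p * μ ℓ + (1 - p) * ν ℓ - ε * (p * (μ ℓ - ν ℓ)) + ε * (μ ℓ - ν ℓ)) *
        Real.log ((p * μ ℓ + (1 - p) * ν ℓ - ε * (p * (μ ℓ - ν ℓ)) + ε * (μ ℓ - ν ℓ)) /
          (p * μ ℓ + (1 - p) * ν ℓ - ε * (p * (μ ℓ - ν ℓ)))) - ε * (μ ℓ - ν ℓ)) / ε ^ 2)
      (nhdsWithin 0 (Set.Ioi 0))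
      (nhds ((μ ℓ - ν ℓ) ^ 2 / (2 * (p * μ ℓ + (1 - p) * ν ℓ)))) := by
    intro ℓ
    have hμ := hμ0 ℓ
    have hν := hν0 ℓ
    refine tendsto_mul_log_div_sub_div_sq
      (B := fun ε => p * μ ℓ + (1 - p) * ν ℓ - ε * (p * (μ ℓ - ν ℓ))) (by positivity) _ ?_
    refine Tendsto.mono_left ?_ nhdsWithin_le_nhds
    exact Continuous.tendsto' (by fun_prop) _ _ (by simp)
  have hsum := (tendsto_finsetSum Finset.univ fun ℓ _ => key ℓ).const_mul lam
  have hlim : lam * ∑ ℓ, (μ ℓ - ν ℓ) ^ 2 / (2 * (p * μ ℓ + (1 - p) * ν ℓ))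
      = (lam / 2) * ∑ ℓ, (μ ℓ - ν ℓ) ^ 2 / (p * μ ℓ + (1 - p) * ν ℓ) := by
    rw [Finset.mul_sum, Finset.mul_sum]
    refine Finset.sum_congr rfl fun ℓ _ => ?_
    rw [← div_div, div_right_comm]
    ring
  rw [hlim] at hsum
  refine hsum.congr fun ε => ?_
  have hzero : ∑ ℓ, ε * (μ ℓ - ν ℓ) = 0 := by
    rw [← Finset.mul_sum, Finset.sum_sub_distrib, hμ1, hν1, sub_self, mul_zero]
  rw [← Finset.sum_div, Finset.sum_sub_distrib, hzero, sub_zero, div_mul_eq_mul_div, mul_div_assoc]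
  congr 2
  refine Finset.sum_congr rfl fun ℓ _ => ?_
  have e1 : p * (1 + ((1 - p) / p) * ε) * μ ℓ + (1 - p) * (1 - ε) * ν ℓ
      = p * μ ℓ + (1 - p) * ν ℓ - ε * (p * (μ ℓ - ν ℓ)) + ε * (μ ℓ - ν ℓ) := by
    field_simp
    ring
  have e2 : (1 - ε) * p * μ ℓ + (1 + (p / (1 - p)) * ε) * (1 - p) * ν ℓ
      = p * μ ℓ + (1 - p) * ν ℓ - ε * (p * (μ ℓ - ν ℓ)) := by
    field_simp
    ring
  have e3 : (1 + ((1 - p) / p) * ε) * p * μ ℓ + (1 - ε) * (1 - p) * ν ℓ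
      = p * (1 + ((1 - p) / p) * ε) * μ ℓ + (1 - p) * (1 - ε) * ν ℓ := by
    ring
  rw [e3, e1, e2]
end

section
/- Let p ∈ (0,1), λ > 0 and let μ, ν be strictly positive probability mass functions on a finite label set L. For ε ∈ (0,1) set a = 1 + ((1−p)/p)ε, b = 1−ε, c = 1 + (p/(1−p))ε. Then lim_{ε→0⁺} (λ/ε²)·∑_{ℓ∈L} ( p·a·μ(ℓ) + (1−p)·b·ν(ℓ) ) · ( log( (a·p·μ(ℓ) + b·(1−p)·ν(ℓ)) / (b·p·μ(ℓ) + c·(1−p)·ν(ℓ)) ) )² = λ·∑_{ℓ∈L} (μ(ℓ)−ν(ℓ))² / (p·μ(ℓ)+(1−p)·ν(ℓ)). -/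
open Filter

/-- The right difference quotient of `log ((s + u ε) / (s - v ε))` at `0` tends to `(u + v) / s`. -/
theorem tendsto_inv_mul_log_div {s : ℝ} (hs : 0 < s) (u v : ℝ) :
    Tendsto (fun ε : ℝ => ε⁻¹ * Real.log ((s + u * ε) / (s - v * ε)))
      (nhdsWithin 0 (Set.Ioi 0)) (nhds ((u + v) / s)) := by
  have hnum : HasDerivAt (fun ε : ℝ => s + u * ε) u 0 := by
    simpa using ((hasDerivAt_id (0 : ℝ)).const_mul u).const_add s
  have hden : HasDerivAt (fun ε : ℝ => s - v * ε) (-v) 0 := by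
    simpa using ((hasDerivAt_id (0 : ℝ)).const_mul v).const_sub s
  have hdiv := (hnum.fun_div hden (by simpa using hs.ne')).log (by simp [hs.ne'])
  convert hdiv.tendsto_slope_zero_right using 2
  · simp [hs.ne']
  · simp only [mul_zero, add_zero, sub_zero]
    field_simp
    ring

/-- The variance term of the Poisson sum in Lemma 1 converges, as `ε → 0⁺`,
to `α₁ = λ·∑ (μ(ℓ)−ν(ℓ))²/(pμ(ℓ)+(1−p)ν(ℓ))`. -/
theorem stmt_12 {L : Type*} [Fintype L] (p lam : ℝ) (hp : p ∈ Set.Ioo (0 : ℝ) 1)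
    (hlam : 0 < lam) (μ ν : L → ℝ) (hμ0 : ∀ ℓ, 0 < μ ℓ) (hν0 : ∀ ℓ, 0 < ν ℓ)
    (hμ1 : ∑ ℓ, μ ℓ = 1) (hν1 : ∑ ℓ, ν ℓ = 1) :
    Tendsto (fun ε : ℝ =>
        (lam / ε ^ 2) * ∑ ℓ,
          (p * (1 + ((1 - p) / p) * ε) * μ ℓ + (1 - p) * (1 - ε) * ν ℓ) *
            (Real.log (((1 + ((1 - p) / p) * ε) * p * μ ℓ + (1 - ε) * (1 - p) * ν ℓ) /
                       ((1 - ε) * p * μ ℓ + (1 + (p / (1 - p)) * ε) * (1 - p) * ν ℓ))) ^ 2)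
      (nhdsWithin 0 (Set.Ioi 0))
      (nhds (lam * ∑ ℓ, (μ ℓ - ν ℓ) ^ 2 / (p * μ ℓ + (1 - p) * ν ℓ))) := by
  obtain ⟨hp0, hp1⟩ := hp
  have hq : 0 < 1 - p := sub_pos.mpr hp1
  have hterm (ℓ : L) : Tendsto (fun ε : ℝ =>
      (p * μ ℓ + (1 - p) * ν ℓ + (1 - p) * (μ ℓ - ν ℓ) * ε) *
        (ε⁻¹ * Real.log ((p * μ ℓ + (1 - p) * ν ℓ + (1 - p) * (μ ℓ - ν ℓ) * ε) /
          (p * μ ℓ + (1 - p) * ν ℓ - p * (μ ℓ - ν ℓ) * ε))) ^ 2)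
      (nhdsWithin 0 (Set.Ioi 0))
      (nhds ((μ ℓ - ν ℓ) ^ 2 / (p * μ ℓ + (1 - p) * ν ℓ))) := by
    have hs : 0 < p * μ ℓ + (1 - p) * ν ℓ :=
      add_pos (mul_pos hp0 (hμ0 ℓ)) (mul_pos hq (hν0 ℓ))
    generalize p * μ ℓ + (1 - p) * ν ℓ = s at hs ⊢
    have hweight : Tendsto (fun ε : ℝ => s + (1 - p) * (μ ℓ - ν ℓ) * ε)
        (nhdsWithin 0 (Set.Ioi 0)) (nhds s) :=
      Tendsto.mono_left (Continuous.tendsto' (by fun_prop) 0 s (by simp)) nhdsWithin_le_nhds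
    convert hweight.mul ((tendsto_inv_mul_log_div hs ((1 - p) * (μ ℓ - ν ℓ))
      (p * (μ ℓ - ν ℓ))).pow 2) using 2
    field_simp
    ring
  refine ((tendsto_finsetSum Finset.univ fun ℓ _ => hterm ℓ).const_mul lam).congr fun ε => ?_
  rw [div_mul_eq_mul_div, mul_div_assoc, Finset.sum_div]
  congr 1
  refine Finset.sum_congr rfl fun ℓ _ => ?_
  have hweight : p * (1 + (1 - p) / p * ε) * μ ℓ + (1 - p) * (1 - ε) * ν ℓ =
      p * μ ℓ + (1 - p) * ν ℓ + (1 - p) * (μ ℓ - ν ℓ) * ε := by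
    field_simp
    ring
  have hnum : (1 + (1 - p) / p * ε) * p * μ ℓ + (1 - ε) * (1 - p) * ν ℓ =
      p * μ ℓ + (1 - p) * ν ℓ + (1 - p) * (μ ℓ - ν ℓ) * ε := by
    rw [← hweight]
    ring
  have hden : (1 - ε) * p * μ ℓ + (1 + p / (1 - p) * ε) * (1 - p) * ν ℓ =
      p * μ ℓ + (1 - p) * ν ℓ - p * (μ ℓ - ν ℓ) * ε := by
    field_simp
    ring
  rw [hweight, hnum, hden, mul_pow, inv_pow]
  ring
end

section
/- Let p ∈ (0,1), λ > 0, and let μ, ν be strictly positive probability mass functions on a finite label set L. Define G: [0,∞) → ℝ by G(α) = (λ/p²)·∑_{ℓ∈L} ν(ℓ)·∫_ℝ ( 1/(1 − p + p·(μ(ℓ)/ν(ℓ))·e^{√α·z − α/2}) − 1 ) φ(z) dz, where φ(z) = (1/√(2π))e^{−z²/2} is the standard Gaussian density. Then G is continuous and nondecreasing on [0,∞). -/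
open MeasureTheory ProbabilityTheory Real

/-- The tangent-line inequality for the convex function `x ↦ 1 / (a + x)`. -/
lemma one_div_add_tangent_le {a u t : ℝ} (ha : 0 < a) (hu : 0 < u) (ht : 0 < t) :
    1 / (a + u) - u / (a + u) ^ 2 * (t - 1) ≤ 1 / (a + u * t) := by
  have h1 : 0 < a + u := by positivity
  have h2 : 0 < a + u * t := by positivity
  have h : 1 / (a + u * t) - (1 / (a + u) - u / (a + u) ^ 2 * (t - 1)) =
      (u * (t - 1)) ^ 2 / ((a + u) ^ 2 * (a + u * t)) := by
    field_simp
    ring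
  have h3 : 0 ≤ (u * (t - 1)) ^ 2 / ((a + u) ^ 2 * (a + u * t)) := by positivity
  linarith

lemma norm_one_div_add_mul_exp_le {a c : ℝ} (ha : 0 < a) (hc : 0 < c) (x : ℝ) :
    ‖1 / (a + c * exp x)‖ ≤ 1 / a := by
  rw [norm_of_nonneg (by positivity)]
  exact one_div_le_one_div_of_le ha (by nlinarith [exp_pos x])

lemma continuous_one_div_add_mul_exp {a c : ℝ} (ha : 0 < a) (hc : 0 < c) :
    Continuous fun x : ℝ ↦ 1 / (a + c * exp x) :=
  continuous_const.div (by fun_prop) fun x ↦ by positivity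

lemma integrable_one_div_add_mul_exp {Ω : Type*} [MeasurableSpace Ω] {P : Measure Ω}
    [IsFiniteMeasure P] {a c : ℝ} (ha : 0 < a) (hc : 0 < c) {X : Ω → ℝ} (hX : Measurable X) :
    Integrable (fun ω ↦ 1 / (a + c * exp (X ω))) P :=
  .of_bound ((continuous_one_div_add_mul_exp ha hc).measurable.comp hX).aestronglyMeasurable
    (1 / a) (.of_forall fun ω ↦ norm_one_div_add_mul_exp_le ha hc (X ω))

lemma integral_exp_sub_half_gaussianReal (v : NNReal) :
    ∫ y, exp (y - v / 2) ∂gaussianReal 0 v = 1 := by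
  have h := congrFun (mgf_id_gaussianReal (μ := 0) (v := v)) 1
  simp only [mgf, id, one_mul, zero_add, one_pow, mul_one] at h
  simp_rw [exp_sub, integral_div]
  rw [h, div_self (exp_ne_zero _)]

lemma integrable_exp_sub_half_gaussianReal (v : NNReal) :
    Integrable (fun y ↦ exp (y - v / 2)) (gaussianReal 0 v) := by
  by_contra h
  simpa [integral_undef h] using integral_exp_sub_half_gaussianReal v

lemma one_div_add_le_integral_gaussianReal {a u : ℝ} (ha : 0 < a) (hu : 0 < u) (v : NNReal) :
    1 / (a + u) ≤ ∫ y, 1 / (a + u * exp (y - v / 2)) ∂gaussianReal 0 v := by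
  have hi := integrable_exp_sub_half_gaussianReal v
  have hi' : Integrable (fun y ↦ u / (a + u) ^ 2 * (exp (y - v / 2) - 1)) (gaussianReal 0 v) :=
    (hi.sub (integrable_const 1)).const_mul _
  calc 1 / (a + u)
      = ∫ y, (1 / (a + u) - u / (a + u) ^ 2 * (exp (y - v / 2) - 1)) ∂gaussianReal 0 v := by
        rw [integral_sub (integrable_const _) hi',
          integral_const_mul, integral_sub hi (integrable_const _),
          integral_exp_sub_half_gaussianReal]
        simp
    _ ≤ _ := integral_mono ((integrable_const _).sub hi')
        (integrable_one_div_add_mul_exp ha hu (by fun_prop))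
        fun y ↦ one_div_add_tangent_le ha hu (exp_pos _)

/-- The expectation of `1 / (a + c * M)`, for `M` a lognormal variable of mean one, increases with
the variance parameter of `M`. -/
lemma integral_one_div_add_lognormal_mono {a c : ℝ} (ha : 0 < a) (hc : 0 < c) (v w : NNReal) :
    ∫ x, 1 / (a + c * exp (x - v / 2)) ∂gaussianReal 0 v ≤
      ∫ x, 1 / (a + c * exp (x - (v + w : NNReal) / 2)) ∂gaussianReal 0 (v + w) := by
  have hconv : gaussianReal 0 (v + w) = gaussianReal 0 v ∗ gaussianReal 0 w := by
    rw [gaussianReal_conv_gaussianReal, add_zero]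
  have hint : Integrable (fun q : ℝ × ℝ ↦ 1 / (a + c * exp (q.1 + q.2 - (v + w : NNReal) / 2)))
      ((gaussianReal 0 v).prod (gaussianReal 0 w)) :=
    integrable_one_div_add_mul_exp ha hc (by fun_prop)
  rw [hconv, integral_conv (integrable_one_div_add_mul_exp ha hc (by fun_prop))]
  refine integral_mono (integrable_one_div_add_mul_exp ha hc (by fun_prop))
    hint.integral_prod_left fun x ↦ ?_
  refine (one_div_add_le_integral_gaussianReal ha (u := c * exp (x - v / 2)) (by positivity)
    w).trans_eq (integral_congr_ae (.of_forall fun y ↦ ?_))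
  simp only [mul_assoc, ← exp_add, NNReal.coe_add]
  ring_nf

lemma integral_one_div_add_exp_sqrt_mul {a c : ℝ} (ha : 0 < a) (hc : 0 < c) (v : NNReal) :
    ∫ z, 1 / (a + c * exp (√v * z - v / 2)) ∂gaussianReal 0 1 =
      ∫ x, 1 / (a + c * exp (x - v / 2)) ∂gaussianReal 0 v := by
  have hmap : gaussianReal 0 v = (gaussianReal 0 1).map (√v * ·) := by
    rw [gaussianReal_map_const_mul, mul_zero, mul_one]
    congr
    ext
    simp
  rw [hmap, integral_map (by fun_prop)
    (integrable_one_div_add_mul_exp ha hc (by fun_prop)).aestronglyMeasurable]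

lemma monotoneOn_integral_one_div_add_exp {a c : ℝ} (ha : 0 < a) (hc : 0 < c) :
    MonotoneOn (fun α ↦ ∫ z, 1 / (a + c * exp (√α * z - α / 2)) ∂gaussianReal 0 1)
      (Set.Ici 0) := by
  intro α hα β hβ hαβ
  lift α to NNReal using hα
  lift β to NNReal using hβ
  obtain ⟨w, rfl⟩ := exists_add_of_le (NNReal.coe_le_coe.mp hαβ)
  simp only [integral_one_div_add_exp_sqrt_mul ha hc]
  exact integral_one_div_add_lognormal_mono ha hc α w

lemma continuous_integral_one_div_add_exp {a c : ℝ} (ha : 0 < a) (hc : 0 < c) :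
    Continuous fun α ↦ ∫ z, 1 / (a + c * exp (√α * z - α / 2)) ∂gaussianReal 0 1 :=
  continuous_of_dominated (bound := fun _ ↦ 1 / a)
    (fun _ ↦ (integrable_one_div_add_mul_exp ha hc (by fun_prop)).aestronglyMeasurable)
    (fun _ ↦ .of_forall fun _ ↦ norm_one_div_add_mul_exp_le ha hc _) (integrable_const _)
    (.of_forall fun _ ↦ (continuous_one_div_add_mul_exp ha hc).comp (by fun_prop))

lemma integral_mul_gaussian_density (f : ℝ → ℝ) :
    ∫ z, f z * (exp (-z ^ 2 / 2) / √(2 * π)) = ∫ z, f z ∂gaussianReal 0 1 := by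
  rw [integral_gaussianReal_eq_integral_smul one_ne_zero]
  refine integral_congr_ae (.of_forall fun z ↦ ?_)
  simp only [gaussianPDFReal, NNReal.coe_one, mul_one, sub_zero, smul_eq_mul]
  ring


/-- The belief-propagation recursion function
`G(α) = (λ/p²)·∑ ν(ℓ)·∫ (1/(1 − p + p·(μ(ℓ)/ν(ℓ))·e^{√α·z − α/2}) − 1)·φ(z) dz`
(with `φ` the standard Gaussian density) is continuous and nondecreasing on `[0,∞)`. -/
theorem stmt_17 {L : Type*} [Fintype L] (p lam : ℝ) (hp : p ∈ Set.Ioo (0 : ℝ) 1)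
    (hlam : 0 < lam) (μ ν : L → ℝ) (hμ0 : ∀ ℓ, 0 < μ ℓ) (hν0 : ∀ ℓ, 0 < ν ℓ)
    (hμ1 : ∑ ℓ, μ ℓ = 1) (hν1 : ∑ ℓ, ν ℓ = 1)
    (G : ℝ → ℝ)
    (hG : ∀ α : ℝ, G α = (lam / p ^ 2) * ∑ ℓ, ν ℓ *
      ∫ z : ℝ,
        (1 / (1 - p + p * (μ ℓ / ν ℓ) * Real.exp (Real.sqrt α * z - α / 2)) - 1)
          * (Real.exp (-z ^ 2 / 2) / Real.sqrt (2 * Real.pi))) :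
    ContinuousOn G (Set.Ici 0) ∧ MonotoneOn G (Set.Ici 0) := by

  have ha : 0 < 1 - p := sub_pos.mpr hp.2
  have hc (ℓ : L) : 0 < p * (μ ℓ / ν ℓ) := mul_pos hp.1 (div_pos (hμ0 ℓ) (hν0 ℓ))
  have hG' : G = fun α ↦ (lam / p ^ 2) * ∑ ℓ, ν ℓ *
      ((∫ z, 1 / (1 - p + p * (μ ℓ / ν ℓ) * exp (√α * z - α / 2)) ∂gaussianReal 0 1) - 1) := by
    ext α
    rw [hG]
    congr 1
    refine Finset.sum_congr rfl fun ℓ _ ↦ ?_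
    rw [integral_mul_gaussian_density, integral_sub
      (integrable_one_div_add_mul_exp ha (hc ℓ) (by fun_prop)) (integrable_const _)]
    simp
  subst hG'
  constructor
  · exact (continuous_const.mul (continuous_finsetSum _ fun ℓ _ ↦ continuous_const.mul
      ((continuous_integral_one_div_add_exp ha (hc ℓ)).sub continuous_const))).continuousOn
  · intro α hα β hβ hαβ
    refine mul_le_mul_of_nonneg_left (Finset.sum_le_sum fun ℓ _ ↦ ?_) (by positivity)
    exact mul_le_mul_of_nonneg_left
      (sub_le_sub_right (monotoneOn_integral_one_div_add_exp ha (hc ℓ) hα hβ hαβ) 1) (hν0 ℓ).le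
end
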